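/- arXiv:2410.02636 — 3 statements merged into one kernel-verified Lean document; each statement's English description precedes it below -/
import Mathlib

section
/- There exists a universal constant C₁ > 1 such that for all ρ, δ ∈ (0,1) there exists d₀ ∈ ℕ such that for every integer d ≥ d₀, all positive integers h, N, and every pair (u₁, u₂) ∈ Bases^{2d}_{ρ,δ} ⊆ ℝ^N × ℝ^N, the probability, under the uniform distribution on h×N sign matrices R ∈ {−1,1}^{h×N}, that both ‖R u₁‖_∞ ≤ 1/√(δd) and ‖R u₂‖_∞ ≤ 1/√(δd), is at most C₁^h·(ρ⁴·δ·d)^{−h}. -/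
open Matrix

noncomputable section

/-- Hamming weight of a vector: number of nonzero coordinates. -/
def hw {N : ℕ} (x : Fin N → ℝ) : ℕ :=
  (Function.support x).ncard

/-- Euclidean (ℓ₂) norm of a vector in `ℝ^N`. -/
def l2 {N : ℕ} (u : Fin N → ℝ) : ℝ := Real.sqrt (∑ i, (u i) ^ 2)

/-- Probability of the event `P` under the uniform distribution on a finite type. -/
def prob {α : Type*} [Fintype α] (P : α → Prop) : ℝ :=
  ({a | P a} : Set α).ncard / Fintype.card α

/-- The `±1` sign matrix encoded by a Boolean matrix. -/
def signMat {h N : ℕ} (s : Fin h → Fin N → Bool) : Matrix (Fin h) (Fin N) ℝ :=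
  fun i j => if s i j then 1 else -1

/-- Compressible vectors: unit vectors of sparsity at most `d` that are
`ρ`-close (in ℓ₂) to a vector supported on at most `δ·d` fewer coordinates. -/
def Comp (N d : ℕ) (ρ δ : ℝ) : Set (Fin N → ℝ) :=
  {u | l2 u = 1 ∧ hw u ≤ d ∧
    ∃ S : Finset (Fin N), (S.card : ℝ) ≤ δ * d ∧
      l2 (fun i => if i ∈ S then 0 else u i) ≤ ρ}

/-- `Bases`: orthonormal pairs with joint support of size at most `d₂` whose
span contains no compressible unit vector. -/
def Bases (N d₂ : ℕ) (ρ δ : ℝ) : Set ((Fin N → ℝ) × (Fin N → ℝ)) :=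
  {p | l2 p.1 = 1 ∧ l2 p.2 = 1 ∧ (∑ i, p.1 i * p.2 i) = 0 ∧
    (Function.support p.1 ∪ Function.support p.2).ncard ≤ d₂ ∧
    ∀ w ∈ Submodule.span ℝ ({p.1, p.2} : Set (Fin N → ℝ)),
      l2 w = 1 → w ∉ Comp N d₂ ρ δ}

/-- The expectation of the cosine of a Rademacher sum is a product of cosines. -/
theorem sum_cos_rademacher {N : ℕ} (b : Fin N → ℝ) :
    ∑ s : Fin N → Bool, Real.cos (∑ j, (if s j then (1 : ℝ) else -1) * b j) =
      2 ^ N * ∏ j, Real.cos (b j) := by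
  have key : ∑ s : Fin N → Bool,
      Complex.exp (((∑ j, (if s j then (1 : ℝ) else -1) * b j : ℝ) : ℂ) * Complex.I) =
      ((2 ^ N * ∏ j, Real.cos (b j) : ℝ) : ℂ) := by
    have h1 : ∀ s : Fin N → Bool,
        Complex.exp (((∑ j, (if s j then (1 : ℝ) else -1) * b j : ℝ) : ℂ) * Complex.I) =
        ∏ j, Complex.exp ((((if s j then (1 : ℝ) else -1) * b j : ℝ) : ℂ) * Complex.I) := by
      intro s
      rw [← Complex.exp_sum, Complex.ofReal_sum, Finset.sum_mul]
    simp_rw [h1]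
    rw [← Fintype.piFinset_univ, ← Finset.prod_univ_sum (fun _ => Finset.univ)
      (fun j (x : Bool) =>
        Complex.exp ((((if x then (1 : ℝ) else -1) * b j : ℝ) : ℂ) * Complex.I))]
    have h2 : ∀ j, ∑ x : Bool,
        Complex.exp ((((if x then (1 : ℝ) else -1) * b j : ℝ) : ℂ) * Complex.I) =
        2 * Complex.cos (b j) := by
      intro j
      rw [Fintype.sum_bool, Complex.two_cos]
      simp
    simp_rw [h2]
    rw [Finset.prod_mul_distrib]
    simp
  have := congrArg Complex.re key
  rw [Complex.re_sum, Complex.ofReal_re] at this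
  simpa only [Complex.exp_ofReal_mul_I_re] using this

theorem sum_sum_cos_sub {ι : Type*} (T : Finset ι) (θ : ι → ℝ) :
    ∑ p ∈ T, ∑ q ∈ T, Real.cos (θ p - θ q) =
      (∑ p ∈ T, Real.cos (θ p)) ^ 2 + (∑ p ∈ T, Real.sin (θ p)) ^ 2 := by
  simp_rw [Real.cos_sub, Finset.sum_add_distrib, sq, Finset.sum_mul_sum]

theorem abs_cos_le_exp {x : ℝ} (hx : |x| ≤ 1) : |Real.cos x| ≤ Real.exp (-(x ^ 2 / 5)) := by
  have hpi := Real.pi_gt_three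
  have hpi' := Real.pi_lt_d2
  obtain ⟨h1, h2⟩ := abs_le.mp hx
  rw [abs_of_nonneg (Real.cos_nonneg_of_mem_Icc ⟨by linarith, by linarith⟩)]
  have hc := Real.cos_le_one_sub_mul_cos_sq (x := x) (by linarith)
  have h5 : 1 / 5 ≤ 2 / Real.pi ^ 2 := by
    rw [div_le_div_iff₀ (by norm_num) (by positivity)]
    nlinarith
  have he := Real.add_one_le_exp (-(x ^ 2 / 5))
  nlinarith [sq_nonneg x]

/-- Geometric tails, summed on both sides of `k`. -/
theorem sum_exp_neg_abs_le {a : ℝ} (ha : 0 < a) (k n : ℕ) :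
    ∑ l ∈ Finset.range n, Real.exp (-(a * |(k : ℝ) - l|)) ≤ 2 * ((1 + a) / a) := by
  have hr1 : Real.exp (-a) < 1 := Real.exp_lt_one_iff.mpr (by linarith)
  have geom : ∀ m : ℕ, ∑ j ∈ Finset.range m, Real.exp (-(a * j)) ≤ (1 + a) / a := by
    intro m
    have h1 : ∀ j : ℕ, Real.exp (-(a * j)) = Real.exp (-a) ^ j := by
      intro j
      rw [← Real.exp_nat_mul]
      ring_nf
    simp_rw [h1]
    refine ((summable_geometric_of_lt_one (Real.exp_pos _).le hr1).sum_le_tsum _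
      (fun i _ => by positivity)).trans ?_
    rw [tsum_geometric_of_lt_one (Real.exp_pos _).le hr1]
    have h2 : Real.exp (-a) ≤ 1 / (1 + a) := by
      rw [Real.exp_neg, ← one_div]
      exact one_div_le_one_div_of_le (by linarith) (by linarith [Real.add_one_le_exp a])
    have h3 : a / (1 + a) ≤ 1 - Real.exp (-a) := by
      have : a / (1 + a) = 1 - 1 / (1 + a) := by field_simp; ring
      linarith
    calc (1 - Real.exp (-a))⁻¹ ≤ (a / (1 + a))⁻¹ := inv_anti₀ (by positivity) h3
      _ = (1 + a) / a := by rw [inv_div]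
  calc ∑ l ∈ Finset.range n, Real.exp (-(a * |(k : ℝ) - l|))
      ≤ ∑ l ∈ Finset.range ((k + 1) + n), Real.exp (-(a * |(k : ℝ) - l|)) :=
        Finset.sum_le_sum_of_subset_of_nonneg
          (Finset.range_subset_range.mpr (by omega)) (fun _ _ _ => (Real.exp_pos _).le)
    _ = ∑ l ∈ Finset.range (k + 1), Real.exp (-(a * |(k : ℝ) - l|)) +
        ∑ l ∈ Finset.range n, Real.exp (-(a * |(k : ℝ) - (k + 1 + l : ℕ)|)) :=
        Finset.sum_range_add _ _ _
    _ ≤ (1 + a) / a + (1 + a) / a := by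
        refine add_le_add ?_ ?_
        · rw [← Finset.sum_flip]
          refine le_trans (Finset.sum_le_sum fun l hl => ?_) (geom (k + 1))
          have hl' : l ≤ k := by simpa [Nat.lt_succ_iff] using hl
          rw [Nat.cast_sub hl', sub_sub_cancel, abs_of_nonneg (Nat.cast_nonneg l)]
        · refine le_trans (Finset.sum_le_sum fun l _ => ?_) (geom n)
          refine Real.exp_le_exp.mpr (neg_le_neg (mul_le_mul_of_nonneg_left ?_ ha.le))
          rw [abs_sub_comm]
          push_cast
          exact le_trans (by linarith) (le_abs_self _)
    _ = 2 * ((1 + a) / a) := by ring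

/-- Gaussian decay of the characteristic function of an incompressible Rademacher sum in the
low-frequency range. -/
theorem abs_prod_cos_le_of_mem_Bases {N d : ℕ} {ρ δ : ℝ} {u₁ u₂ : Fin N → ℝ}
    (hu : (u₁, u₂) ∈ Bases N d ρ δ) (hρ : 0 ≤ ρ) (x y : ℝ) (hxy : x ^ 2 + y ^ 2 ≤ δ * d) :
    |∏ j, Real.cos (x * u₁ j + y * u₂ j)| ≤ Real.exp (-(ρ ^ 2 / 5 * (x ^ 2 + y ^ 2))) := by
  obtain ⟨h1, h2, h12, hsupp, hcomp⟩ := hu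
  simp only at h1 h2 h12 hsupp hcomp
  simp only [l2, Real.sqrt_eq_one] at h1 h2
  set b : Fin N → ℝ := fun j => x * u₁ j + y * u₂ j with hb
  have hbsum : ∑ j, b j ^ 2 = x ^ 2 + y ^ 2 := by
    have : ∀ j, b j ^ 2 = x ^ 2 * u₁ j ^ 2 + y ^ 2 * u₂ j ^ 2 + 2 * x * y * (u₁ j * u₂ j) := by
      intro j; simp only [hb]; ring
    simp_rw [this, Finset.sum_add_distrib, ← Finset.mul_sum, h1, h2, h12]
    ring
  rcases (add_nonneg (sq_nonneg x) (sq_nonneg y)).eq_or_lt with h0 | hpos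
  · rw [← h0, Finset.abs_prod]
    simpa using Finset.prod_le_one (fun j _ => abs_nonneg _)
      (fun j _ => Real.abs_cos_le_one (b j))
  set S : Finset (Fin N) := Finset.univ.filter fun j => 1 < |b j| with hS
  have hScard : (S.card : ℝ) ≤ δ * d := by
    refine le_trans ?_ hxy
    rw [← hbsum, Finset.card_eq_sum_ones, Nat.cast_sum]
    refine le_trans (Finset.sum_le_sum (g := fun j => b j ^ 2) fun j hj => ?_)
      (Finset.sum_le_univ_sum_of_nonneg fun j => sq_nonneg _)
    have hj' : 1 < |b j| := by simpa [hS] using hj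
    rw [← sq_abs]
    push_cast
    nlinarith
  set σ : ℝ := Real.sqrt (x ^ 2 + y ^ 2) with hσ
  have hσpos : 0 < σ := Real.sqrt_pos.mpr hpos
  have hσsq : σ ^ 2 = x ^ 2 + y ^ 2 := Real.sq_sqrt hpos.le
  set w : Fin N → ℝ := fun j => b j / σ with hw'
  have hwspan : w ∈ Submodule.span ℝ ({u₁, u₂} : Set (Fin N → ℝ)) := by
    rw [Submodule.mem_span_pair]
    refine ⟨x / σ, y / σ, ?_⟩
    ext j
    simp only [hw', hb, Pi.add_apply, Pi.smul_apply, smul_eq_mul]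
    ring
  have hwl2 : l2 w = 1 := by
    simp only [l2, hw', div_pow, Real.sqrt_eq_one]
    rw [← Finset.sum_div, hbsum, hσsq, div_self hpos.ne']
  have hwhw : hw w ≤ d := by
    refine le_trans (Set.ncard_le_ncard ?_ (Set.toFinite _)) hsupp
    intro j hj
    by_contra hcon
    simp only [Set.mem_union, Function.mem_support, not_or, not_not] at hcon
    simp [hw', hb, hcon.1, hcon.2] at hj
  have hmass : ρ ^ 2 * (x ^ 2 + y ^ 2) ≤ ∑ j ∈ Finset.univ.filter (fun j => ¬ 1 < |b j|),
      b j ^ 2 := by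
    have hnot := hcomp w hwspan hwl2
    have hlt : ρ < l2 (fun i => if i ∈ S then 0 else w i) := by
      by_contra hle
      exact hnot ⟨hwl2, hwhw, S, hScard, not_lt.mp hle⟩
    rw [l2, Real.lt_sqrt hρ] at hlt
    have heq : ∑ i, (if i ∈ S then 0 else w i) ^ 2 =
        (∑ j ∈ Finset.univ.filter (fun j => ¬ 1 < |b j|), b j ^ 2) / σ ^ 2 := by
      rw [Finset.sum_div, Finset.sum_filter]
      refine Finset.sum_congr rfl fun j _ => ?_
      by_cases hj : 1 < |b j|
      · simp [hS, hj]
      · simp only [hS, Finset.mem_filter, Finset.mem_univ, true_and, hj, if_false,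
          not_false_eq_true, if_true, hw', div_pow]
    rw [heq, lt_div_iff₀ (by positivity), hσsq] at hlt
    exact hlt.le
  rw [Finset.abs_prod]
  calc ∏ j, |Real.cos (b j)|
      = (∏ j ∈ Finset.univ.filter (fun j => 1 < |b j|), |Real.cos (b j)|) *
        ∏ j ∈ Finset.univ.filter (fun j => ¬ 1 < |b j|), |Real.cos (b j)| :=
        (Finset.prod_filter_mul_prod_filter_not _ _ _).symm
    _ ≤ 1 * ∏ j ∈ Finset.univ.filter (fun j => ¬ 1 < |b j|), Real.exp (-(b j ^ 2 / 5)) := by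
        refine mul_le_mul
          (Finset.prod_le_one (fun j _ => abs_nonneg _) fun j _ => Real.abs_cos_le_one _)
          (Finset.prod_le_prod (fun j _ => abs_nonneg _) fun j hj => abs_cos_le_exp ?_)
          (Finset.prod_nonneg fun j _ => abs_nonneg _) zero_le_one
        simpa using hj
    _ ≤ Real.exp (-(ρ ^ 2 / 5 * (x ^ 2 + y ^ 2))) := by
        rw [one_mul, ← Real.exp_sum, Real.exp_le_exp, Finset.sum_neg_distrib, ← Finset.sum_div]
        linarith

/-- Two-dimensional Esseen-type inequality for a Rademacher sum, with a discrete set of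
frequencies. -/
theorem card_mul_le_sum_abs_prod_cos {N : ℕ} (u₁ u₂ : Fin N → ℝ) (M : ℕ) {t : ℝ}
    (ht : M * t ≤ 1 / 2) :
    ((Finset.univ.filter fun s : Fin N → Bool =>
        |∑ j, (if s j then (1 : ℝ) else -1) * u₁ j| ≤ t ∧
        |∑ j, (if s j then (1 : ℝ) else -1) * u₂ j| ≤ t).card : ℝ) * ((M : ℝ) ^ 4 / 4) ≤
      2 ^ N * ∑ p ∈ Finset.range M ×ˢ Finset.range M, ∑ q ∈ Finset.range M ×ˢ Finset.range M,
        |∏ j, Real.cos (((p.1 : ℝ) - q.1) * u₁ j + ((p.2 : ℝ) - q.2) * u₂ j)| := by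
  set X : (Fin N → Bool) → ℝ := fun s => ∑ j, (if s j then (1 : ℝ) else -1) * u₁ j with hX
  set Y : (Fin N → Bool) → ℝ := fun s => ∑ j, (if s j then (1 : ℝ) else -1) * u₂ j with hY
  set T := Finset.range M ×ˢ Finset.range M with hT
  have hF : ∀ s, ∑ p ∈ T, ∑ q ∈ T,
      Real.cos ((p.1 * X s + p.2 * Y s) - (q.1 * X s + q.2 * Y s)) =
      (∑ p ∈ T, Real.cos (p.1 * X s + p.2 * Y s)) ^ 2 +
      (∑ p ∈ T, Real.sin (p.1 * X s + p.2 * Y s)) ^ 2 := fun s =>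
    sum_sum_cos_sub T fun p : ℕ × ℕ => (p.1 : ℝ) * X s + p.2 * Y s
  have hlow : ∀ s, |X s| ≤ t → |Y s| ≤ t → (M : ℝ) ^ 4 / 4 ≤ ∑ p ∈ T, ∑ q ∈ T,
      Real.cos ((p.1 * X s + p.2 * Y s) - (q.1 * X s + q.2 * Y s)) := by
    intro s hx hy
    have hcos : ∀ p ∈ T, 1 / 2 ≤ Real.cos (p.1 * X s + p.2 * Y s) := by
      intro p hp
      obtain ⟨hp1, hp2⟩ := Finset.mem_product.mp hp
      have e1 : (p.1 : ℝ) ≤ M := by exact_mod_cast (Finset.mem_range.mp hp1).le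
      have e2 : (p.2 : ℝ) ≤ M := by exact_mod_cast (Finset.mem_range.mp hp2).le
      have ht0 : 0 ≤ t := (abs_nonneg _).trans hx
      have habs : |p.1 * X s + p.2 * Y s| ≤ 1 := by
        calc |p.1 * X s + p.2 * Y s| ≤ |p.1 * X s| + |p.2 * Y s| := abs_add_le _ _
          _ = p.1 * |X s| + p.2 * |Y s| := by simp [abs_mul]
          _ ≤ M * t + M * t := by gcongr
          _ ≤ 1 := by linarith
      have := Real.one_sub_sq_div_two_le_cos (x := p.1 * X s + p.2 * Y s)
      have hsq := (sq_le_one_iff_abs_le_one _).mpr habs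
      linarith
    have hsum : (M : ℝ) ^ 2 / 2 ≤ ∑ p ∈ T, Real.cos (p.1 * X s + p.2 * Y s) := by
      have := Finset.card_nsmul_le_sum T _ _ hcos
      simp only [hT, Finset.card_product, Finset.card_range, nsmul_eq_mul] at this
      push_cast at this
      linarith
    rw [hF]
    calc (M : ℝ) ^ 4 / 4 = ((M : ℝ) ^ 2 / 2) ^ 2 := by ring
      _ ≤ (∑ p ∈ T, Real.cos (p.1 * X s + p.2 * Y s)) ^ 2 := by gcongr
      _ ≤ _ := le_add_of_nonneg_right (sq_nonneg _)
  rw [← nsmul_eq_mul]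
  calc _ ≤ ∑ s ∈ Finset.univ.filter (fun s => |X s| ≤ t ∧ |Y s| ≤ t), ∑ p ∈ T, ∑ q ∈ T,
        Real.cos ((p.1 * X s + p.2 * Y s) - (q.1 * X s + q.2 * Y s)) :=
        Finset.card_nsmul_le_sum _ _ _ fun s hs => by
          obtain ⟨hx, hy⟩ := (Finset.mem_filter.mp hs).2
          exact hlow s hx hy
    _ ≤ ∑ s, ∑ p ∈ T, ∑ q ∈ T,
        Real.cos ((p.1 * X s + p.2 * Y s) - (q.1 * X s + q.2 * Y s)) :=
        Finset.sum_le_univ_sum_of_nonneg fun s => by rw [hF]; positivity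
    _ = ∑ p ∈ T, ∑ q ∈ T, ∑ s,
        Real.cos ((p.1 * X s + p.2 * Y s) - (q.1 * X s + q.2 * Y s)) := by
        rw [Finset.sum_comm]
        exact Finset.sum_congr rfl fun p _ => Finset.sum_comm
    _ = ∑ p ∈ T, ∑ q ∈ T, 2 ^ N *
        ∏ j, Real.cos (((p.1 : ℝ) - q.1) * u₁ j + ((p.2 : ℝ) - q.2) * u₂ j) := by
        refine Finset.sum_congr rfl fun p _ => Finset.sum_congr rfl fun q _ => ?_
        rw [← sum_cos_rademacher]
        refine Finset.sum_congr rfl fun s _ => congrArg Real.cos ?_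
        simp only [hX, hY, Finset.mul_sum]
        rw [← Finset.sum_add_distrib, ← Finset.sum_add_distrib, ← Finset.sum_sub_distrib]
        exact Finset.sum_congr rfl fun j _ => by ring
    _ ≤ _ := by
        simp_rw [Finset.mul_sum]
        gcongr
        exact le_abs_self _

/-- Small-ball estimate for a single random row. -/
theorem card_row_le_of_mem_Bases {N d : ℕ} {ρ δ : ℝ} {u₁ u₂ : Fin N → ℝ}
    (hu : (u₁, u₂) ∈ Bases N (2 * d) ρ δ) (hρ : 0 < ρ) (hρ1 : ρ < 1) (hd : 4 ≤ δ * d) :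
    ((Finset.univ.filter fun s : Fin N → Bool =>
        |∑ j, (if s j then (1 : ℝ) else -1) * u₁ j| ≤ 1 / Real.sqrt (δ * d) ∧
        |∑ j, (if s j then (1 : ℝ) else -1) * u₂ j| ≤ 1 / Real.sqrt (δ * d)).card : ℝ) ≤
      2 ^ N * (9216 * (ρ ^ 4 * δ * d)⁻¹) := by
  set r := Real.sqrt (δ * d) with hr
  have hr2 : 2 ≤ r := Real.le_sqrt_of_sq_le (by linarith)
  have hrsq : r ^ 2 = δ * d := Real.sq_sqrt (by linarith)
  set M := ⌊r / 2⌋₊ with hM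
  have hM1 : 1 ≤ M := Nat.le_floor (by push_cast; linarith)
  have hMle : (M : ℝ) ≤ r / 2 := Nat.floor_le (by linarith)
  have hMge : r / 4 ≤ M := by
    have h1 : r / 2 < M + 1 := Nat.lt_floor_add_one _
    have h2 : (1 : ℝ) ≤ M := by exact_mod_cast hM1
    linarith
  have hMpos : (0 : ℝ) < M := by linarith
  have hMt : M * (1 / r) ≤ 1 / 2 := by
    rw [mul_one_div, div_le_iff₀ (by linarith)]
    linarith
  have hesseen := card_mul_le_sum_abs_prod_cos u₁ u₂ M hMt
  set A : ℝ := ((Finset.univ.filter fun s : Fin N → Bool =>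
        |∑ j, (if s j then (1 : ℝ) else -1) * u₁ j| ≤ 1 / r ∧
        |∑ j, (if s j then (1 : ℝ) else -1) * u₂ j| ≤ 1 / r).card : ℝ)
  set a := ρ ^ 2 / 5 with ha
  have hapos : 0 < a := by positivity
  set e : ℕ → ℕ → ℝ := fun k l => Real.exp (-(a * |(k : ℝ) - l|)) with he
  have habs_sq : ∀ k l : ℕ, |(k : ℝ) - l| ≤ ((k : ℝ) - l) ^ 2 := by
    intro k l
    have hz : |(k : ℤ) - l| ≤ ((k : ℤ) - l) ^ 2 := by
      rw [← sq_abs]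
      exact Int.le_self_sq _
    exact_mod_cast hz
  have hdiff : ∀ k ∈ Finset.range M, ∀ l ∈ Finset.range M, ((k : ℝ) - l) ^ 2 ≤ (M : ℝ) ^ 2 := by
    intro k hk l hl
    have hk' : (k : ℝ) ≤ M := by exact_mod_cast (Finset.mem_range.mp hk).le
    have hl' : (l : ℝ) ≤ M := by exact_mod_cast (Finset.mem_range.mp hl).le
    have hk0 : (0 : ℝ) ≤ k := k.cast_nonneg
    have hl0 : (0 : ℝ) ≤ l := l.cast_nonneg
    exact sq_le_sq' (by linarith) (by linarith)
  have hterm : ∀ p ∈ Finset.range M ×ˢ Finset.range M, ∀ q ∈ Finset.range M ×ˢ Finset.range M,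
      |∏ j, Real.cos (((p.1 : ℝ) - q.1) * u₁ j + ((p.2 : ℝ) - q.2) * u₂ j)| ≤
        e p.1 q.1 * e p.2 q.2 := by
    intro p hp q hq
    obtain ⟨hp1, hp2⟩ := Finset.mem_product.mp hp
    obtain ⟨hq1, hq2⟩ := Finset.mem_product.mp hq
    refine (abs_prod_cos_le_of_mem_Bases hu hρ.le _ _ ?_).trans ?_
    · have := hdiff _ hp1 _ hq1
      have := hdiff _ hp2 _ hq2
      push_cast
      nlinarith
    · rw [he, ← Real.exp_add, Real.exp_le_exp]
      have := habs_sq p.1 q.1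
      have := habs_sq p.2 q.2
      nlinarith
  have hinner : ∑ k ∈ Finset.range M, ∑ l ∈ Finset.range M, e k l ≤ M * (12 / ρ ^ 2) := by
    have hone : ∀ k ∈ Finset.range M, ∑ l ∈ Finset.range M, e k l ≤ 12 / ρ ^ 2 := by
      intro k _
      refine (sum_exp_neg_abs_le hapos k M).trans ?_
      rw [ha, ← mul_div_assoc, div_le_div_iff₀ (by positivity) (by positivity)]
      nlinarith [pow_pos hρ 2, pow_pos hρ 4, pow_le_one₀ (n := 2) hρ.le hρ1.le]
    simpa using Finset.sum_le_card_nsmul _ _ _ hone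
  have hsum : ∑ p ∈ Finset.range M ×ˢ Finset.range M, ∑ q ∈ Finset.range M ×ˢ Finset.range M,
      |∏ j, Real.cos (((p.1 : ℝ) - q.1) * u₁ j + ((p.2 : ℝ) - q.2) * u₂ j)| ≤
      (M * (12 / ρ ^ 2)) ^ 2 := by
    calc _ ≤ ∑ p ∈ Finset.range M ×ˢ Finset.range M, ∑ q ∈ Finset.range M ×ˢ Finset.range M,
          e p.1 q.1 * e p.2 q.2 :=
          Finset.sum_le_sum fun p hp => Finset.sum_le_sum fun q hq => hterm p hp q hq
      _ = (∑ k ∈ Finset.range M, ∑ l ∈ Finset.range M, e k l) ^ 2 := by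
          rw [sq, Finset.sum_mul_sum, Finset.sum_product]
          refine Finset.sum_congr rfl fun k _ => Finset.sum_congr rfl fun k' _ => ?_
          rw [Finset.sum_mul_sum, Finset.sum_product]
      _ ≤ _ := by
          have : 0 ≤ ∑ k ∈ Finset.range M, ∑ l ∈ Finset.range M, e k l :=
            Finset.sum_nonneg fun k _ => Finset.sum_nonneg fun l _ => (Real.exp_pos _).le
          gcongr
  have h2N : (0 : ℝ) < 2 ^ N := by positivity
  have hA : A * ((M : ℝ) ^ 4 / 4) ≤ 2 ^ N * (M * (12 / ρ ^ 2)) ^ 2 :=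
    hesseen.trans (mul_le_mul_of_nonneg_left hsum h2N.le)
  have hA' : A ≤ 2 ^ N * (576 / (ρ ^ 4 * (M : ℝ) ^ 2)) := by
    rw [← le_div_iff₀ (by positivity)] at hA
    refine hA.trans_eq ?_
    field_simp
    norm_num
  refine hA'.trans (mul_le_mul_of_nonneg_left ?_ h2N.le)
  rw [mul_assoc, ← hrsq, ← div_eq_mul_inv, div_le_div_iff₀ (by positivity) (by positivity)]
  have : r ^ 2 ≤ 16 * (M : ℝ) ^ 2 := by nlinarith
  nlinarith [mul_le_mul_of_nonneg_left this (pow_pos hρ 4).le]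

/-- Events that constrain the rows independently and identically have product probability. -/
theorem prob_forall_row {h : ℕ} {β : Type*} [Fintype β] (Q : β → Prop) [DecidablePred Q] :
    prob (fun s : Fin h → β => ∀ i, Q (s i)) =
      (((Finset.univ.filter Q).card : ℝ) / Fintype.card β) ^ h := by
  have hset : ({s | ∀ i, Q (s i)} : Set (Fin h → β)) =
      ↑(Fintype.piFinset fun _ : Fin h => Finset.univ.filter Q) := by
    ext s
    simp
  rw [prob, hset, Set.ncard_coe_finset, Fintype.card_piFinset, Fintype.card_fun]
  simp [div_pow]

theorem stmt11 : ∃ C₁ : ℝ, 1 < C₁ ∧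
    ∀ ρ δ : ℝ, ρ ∈ Set.Ioo (0 : ℝ) 1 → δ ∈ Set.Ioo (0 : ℝ) 1 →
      ∃ d₀ : ℕ, ∀ d : ℕ, d₀ ≤ d → ∀ h N : ℕ, 0 < h → 0 < N →
        ∀ u₁ u₂ : Fin N → ℝ, (u₁, u₂) ∈ Bases N (2 * d) ρ δ →
          prob (fun s : Fin h → Fin N → Bool =>
            (∀ i, |(signMat s).mulVec u₁ i| ≤ 1 / Real.sqrt (δ * d)) ∧
            (∀ i, |(signMat s).mulVec u₂ i| ≤ 1 / Real.sqrt (δ * d))) ≤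
          C₁ ^ h * (ρ ^ 4 * δ * d) ^ (-(h : ℤ)) := by
  refine ⟨9216, by norm_num, fun ρ δ hρ hδ => ⟨⌈4 / δ⌉₊, fun d hd h N _ _ u₁ u₂ hu => ?_⟩⟩
  have hδd : 4 ≤ δ * d := by
    have := (Nat.le_ceil (4 / δ)).trans (Nat.cast_le.mpr hd)
    rwa [div_le_iff₀' hδ.1] at this
  have hrow := card_row_le_of_mem_Bases hu hρ.1 hρ.2 hδd
  have hevent : (fun s : Fin h → Fin N → Bool =>
      (∀ i, |(signMat s).mulVec u₁ i| ≤ 1 / Real.sqrt (δ * d)) ∧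
      (∀ i, |(signMat s).mulVec u₂ i| ≤ 1 / Real.sqrt (δ * d))) =
      fun s : Fin h → Fin N → Bool => ∀ i, (fun r : Fin N → Bool =>
        |∑ j, (if r j then (1 : ℝ) else -1) * u₁ j| ≤ 1 / Real.sqrt (δ * d) ∧
        |∑ j, (if r j then (1 : ℝ) else -1) * u₂ j| ≤ 1 / Real.sqrt (δ * d)) (s i) := by
    funext s
    exact propext forall_and.symm
  rw [hevent, prob_forall_row (fun r : Fin N → Bool =>
    |∑ j, (if r j then (1 : ℝ) else -1) * u₁ j| ≤ 1 / Real.sqrt (δ * d) ∧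
    |∑ j, (if r j then (1 : ℝ) else -1) * u₂ j| ≤ 1 / Real.sqrt (δ * d)),
    _root_.zpow_neg, zpow_natCast, ← inv_pow, ← mul_pow]
  refine pow_le_pow_left₀ (by positivity) ?_ h
  rw [div_le_iff₀' (by positivity)]
  simpa using hrow
end
end

section
/- Let C ⊆ ℝ^N be a linear subspace, T an n×N real matrix, and k ≥ 1 an integer, and suppose that for every x ∈ {0,1}^n there exists y ∈ C all of whose coordinates are 0 or 1, with ‖y‖₀ = k and T·y = x. Let Q_1, …, Q_m be n×n real matrices, b ∈ ℝ^m, and suppose x ∈ {0,1}^n satisfies Q_ℓ(xxᵀ) = b_ℓ for all ℓ ∈ {1,…,m}. Then there exists a symmetric matrix Y ∈ ℝ^{N×N}, all of whose entries are 0 or 1, with Y ≠ 0, every row and every column of Y lying in C, ‖Y‖₀ = k², Σᵢ Y[i,i] = k, and Q_ℓ(T·Y·Tᵀ) = b_ℓ for all ℓ ∈ {1,…,m}. -/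
open Matrix

noncomputable section

/-- Hamming weight of a matrix: number of nonzero entries. -/
def hwM {n m : ℕ} (M : Matrix (Fin n) (Fin m) ℝ) : ℕ :=
  (Function.support fun p : Fin n × Fin m => M p.1 p.2).ncard

/-- Evaluation of the homogeneous quadratic form with coefficient matrix `Q`
on a matrix `X`: `Q(X) = ∑ i j, Q[i,j]·X[i,j]`. -/
def Qapp {n : ℕ} (Q X : Matrix (Fin n) (Fin n) ℝ) : ℝ :=
  ∑ i, ∑ j, Q i j * X i j

theorem hwM_vecMulVec {N : ℕ} (y : Fin N → ℝ) : hwM (vecMulVec y y) = hw y ^ 2 := by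
  have h : (Function.support fun p : Fin N × Fin N => vecMulVec y y p.1 p.2) =
      Function.support y ×ˢ Function.support y := by
    ext p
    simp [vecMulVec_apply]
  rw [hwM, h, Set.ncard_prod, hw, sq]

theorem sum_eq_hw {N : ℕ} (y : Fin N → ℝ) (hy : ∀ j, y j = 0 ∨ y j = 1) :
    ∑ i, y i = hw y := by
  classical
  have h : Function.support y = ↑(Finset.univ.filter fun i => y i ≠ 0) := by
    ext i
    simp
  rw [hw, h, Set.ncard_coe_finset, Finset.card_filter, Nat.cast_sum]
  refine Finset.sum_congr rfl fun i _ => ?_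
  rcases hy i with h | h <;> simp [h]

theorem stmt15 {N n m : ℕ} (C : Submodule ℝ (Fin N → ℝ))
    (T : Matrix (Fin n) (Fin N) ℝ) (k : ℕ) (hk : 1 ≤ k)
    (hWLD : ∀ x : Fin n → ℝ, (∀ i, x i = 0 ∨ x i = 1) →
      ∃ y ∈ C, (∀ j, y j = 0 ∨ y j = 1) ∧ hw y = k ∧ T.mulVec y = x)
    (Q : Fin m → Matrix (Fin n) (Fin n) ℝ) (b : Fin m → ℝ)
    (x : Fin n → ℝ) (hx01 : ∀ i, x i = 0 ∨ x i = 1)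
    (hx : ∀ ℓ, Qapp (Q ℓ) (vecMulVec x x) = b ℓ) :
    ∃ Y : Matrix (Fin N) (Fin N) ℝ,
      Yᵀ = Y ∧ (∀ i j, Y i j = 0 ∨ Y i j = 1) ∧ Y ≠ 0 ∧
      (∀ i, (fun j => Y i j) ∈ C) ∧ (∀ j, (fun i => Y i j) ∈ C) ∧
      hwM Y = k ^ 2 ∧ (∑ i, Y i i) = (k : ℝ) ∧
      ∀ ℓ, Qapp (Q ℓ) (T * Y * Tᵀ) = b ℓ := by
  obtain ⟨y, hyC, hy01, hyk, hTy⟩ := hWLD x hx01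
  have hdiag : ∑ i, vecMulVec y y i i = (k : ℝ) := by
    rw [← hyk, ← sum_eq_hw y hy01]
    refine Finset.sum_congr rfl fun i _ => ?_
    rcases hy01 i with h | h <;> simp [vecMulVec_apply, h]
  refine ⟨vecMulVec y y, transpose_vecMulVec y y, fun i j => ?_, fun h => ?_, fun i => ?_,
    fun j => ?_, by rw [hwM_vecMulVec, hyk], hdiag, fun ℓ => ?_⟩
  · rcases hy01 i with h | h <;> rcases hy01 j with h' | h' <;> simp [vecMulVec_apply, h, h']
  · rw [h] at hdiag
    simp only [Matrix.zero_apply, Finset.sum_const_zero] at hdiag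
    have : k = 0 := by exact_mod_cast hdiag.symm
    omega
  · exact C.smul_mem (y i) hyC
  · simpa only [vecMulVec_apply, mul_comm, Pi.smul_def, smul_eq_mul] using C.smul_mem (y j) hyC
  · rw [mul_vecMulVec, vecMulVec_mul, vecMul_transpose, hTy]
    exact hx ℓ
end
end

section
/- Let C ⊆ ℝ^N be a linear subspace containing a nonzero vector, with minimum distance d := d(C), let α ≥ 1 be a real number such that C is α-non-overlapping, let T be an n×N real matrix, let k > 0 be real, let Q_1, …, Q_m be n×n real matrices and b ∈ ℝ^m. Suppose Y ∈ ℝ^{N×N} is a nonzero symmetric matrix such that every row and every column of Y lies in C, ‖Y‖₀ < α·d², and, setting z := (Σᵢ Y[i,i])/k, Q_ℓ(T·Y·Tᵀ) = z·b_ℓ for all ℓ ∈ {1,…,m}. Then there exists w ∈ ℝ^n such that Q_ℓ(wwᵀ) = b_ℓ for all ℓ ∈ {1,…,m}. -/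
open Matrix

noncomputable section

/-- Minimum distance of a linear code over ℝ. -/
def dmin {N : ℕ} (C : Submodule ℝ (Fin N → ℝ)) : ℕ :=
  sInf {w | ∃ u ∈ C, u ≠ 0 ∧ hw u = w}

/-- `C` is `α`-non-overlapping. -/
def NonOverlapping {N : ℕ} (C : Submodule ℝ (Fin N → ℝ)) (α : ℝ) : Prop :=
  ∀ u ∈ C, ∀ v ∈ C, LinearIndependent ℝ ![u, v] →
    α * (dmin C : ℝ) ≤ ((Function.support u ∪ Function.support v).ncard : ℝ)

/-- Every nonzero codeword has weight at least the minimum distance. -/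
lemma dmin_le_hw {N : ℕ} {C : Submodule ℝ (Fin N → ℝ)} {u : Fin N → ℝ} (hu : u ∈ C)
    (hu0 : u ≠ 0) : dmin C ≤ hw u :=
  Nat.sInf_le ⟨u, hu, hu0, rfl⟩

/-- The weight of a matrix is the sum of the weights of its columns. -/
lemma hwM_eq_sum_hw_col {n m : ℕ} (M : Matrix (Fin n) (Fin m) ℝ) :
    hwM M = ∑ j, hw fun i => M i j := by
  classical
  simp only [hwM, hw, Set.ncard_eq_toFinset_card']
  rw [Finset.card_eq_sum_card_fiberwise (f := Prod.snd) (t := Finset.univ) (by simp)]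
  refine Finset.sum_congr rfl fun j _ => ?_
  refine Finset.card_bij' (fun p _ => p.1) (fun i _ => (i, j)) ?_ ?_ ?_ ?_ <;>
    aesop

/-- If all columns of `M` lie in `C` and those indexed by `S` are nonzero, then `M` has
weight at least `|S| · d(C)`. -/
lemma ncard_mul_dmin_le_hwM {N m : ℕ} {C : Submodule ℝ (Fin N → ℝ)}
    {M : Matrix (Fin N) (Fin m) ℝ} (hcols : ∀ j, (fun i => M i j) ∈ C) (S : Set (Fin m))
    (hS : ∀ j ∈ S, ∃ i, M i j ≠ 0) : S.ncard * dmin C ≤ hwM M := by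
  classical
  rw [hwM_eq_sum_hw_col, Set.ncard_eq_toFinset_card']
  calc S.toFinset.card * dmin C ≤ ∑ j ∈ S.toFinset, hw fun i => M i j := by
        rw [← smul_eq_mul]
        refine Finset.card_nsmul_le_sum _ _ _ fun j hj => dmin_le_hw (hcols j) fun h => ?_
        obtain ⟨i, hi⟩ := hS j (Set.mem_toFinset.mp hj)
        exact hi (congrFun h i)
    _ ≤ _ := Finset.sum_le_sum_of_subset (Finset.subset_univ _)

/-- A matrix of weight less than `α · d(C)²` with rows and columns in an `α`-non-overlapping
code has no two linearly independent rows. -/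
lemma NonOverlapping.not_linearIndependent_rows {N : ℕ} {C : Submodule ℝ (Fin N → ℝ)} {α : ℝ}
    (hno : NonOverlapping C α) {Y : Matrix (Fin N) (Fin N) ℝ}
    (hrows : ∀ i, (fun j => Y i j) ∈ C) (hcols : ∀ j, (fun i => Y i j) ∈ C)
    (hhw : (hwM Y : ℝ) < α * (dmin C : ℝ) ^ 2) (a b : Fin N) :
    ¬ LinearIndependent ℝ ![Y a, Y b] := by
  intro hli
  have hsupp := hno _ (hrows a) _ (hrows b) hli
  have hcard := ncard_mul_dmin_le_hwM hcols (Function.support (Y a) ∪ Function.support (Y b))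
    (by rintro j (hj | hj) <;> exact ⟨_, hj⟩)
  have hcard' : ((Function.support (Y a) ∪ Function.support (Y b)).ncard : ℝ) * dmin C ≤ hwM Y :=
    mod_cast hcard
  have := mul_le_mul_of_nonneg_right hsupp (Nat.cast_nonneg (α := ℝ) (dmin C))
  linarith

/-- A nonzero symmetric matrix without two linearly independent rows is a nonzero multiple of
`u uᵀ` for some `u ≠ 0`. -/
lemma exists_eq_smul_vecMulVec_self {N : ℕ} {Y : Matrix (Fin N) (Fin N) ℝ} (hY0 : Y ≠ 0)
    (hYsym : Yᵀ = Y) (hdep : ∀ a b, ¬ LinearIndependent ℝ ![Y a, Y b]) :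
    ∃ (c : ℝ) (u : Fin N → ℝ), c ≠ 0 ∧ u ≠ 0 ∧ Y = c • vecMulVec u u := by
  obtain ⟨a, ha⟩ : ∃ a, Y a ≠ 0 := Function.ne_iff.mp hY0
  have hrow : ∀ i, ∃ r : ℝ, r • Y a = Y i := fun i => by
    simpa [LinearIndependent.pair_iff' ha] using hdep a i
  choose r hr using hrow
  have hentry : ∀ i j, Y i j = r i * Y a j := fun i j => (congrFun (hr i) j).symm
  have hsym : ∀ i j, Y i j = Y j i := fun i j => congrFun (congrFun hYsym j) i
  have hcol : ∀ i, Y a i = r i * Y a a := fun i => (hsym a i).trans (hentry i a)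
  have haa : Y a a ≠ 0 := fun h => ha (funext fun i => by simp [hcol i, h])
  refine ⟨(Y a a)⁻¹, Y a, inv_ne_zero haa, ha, ?_⟩
  ext i j
  rw [hentry i j, Matrix.smul_apply, vecMulVec_apply, hcol i, smul_eq_mul]
  field_simp

lemma Qapp_smul {n : ℕ} (Q X : Matrix (Fin n) (Fin n) ℝ) (c : ℝ) :
    Qapp Q (c • X) = c * Qapp Q X := by
  simp only [Qapp, Finset.mul_sum, Matrix.smul_apply, smul_eq_mul, mul_left_comm]

theorem stmt16 {N n m : ℕ} (C : Submodule ℝ (Fin N → ℝ)) (hC : ∃ u ∈ C, u ≠ 0)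
    (α : ℝ) (hα : 1 ≤ α) (hno : NonOverlapping C α)
    (T : Matrix (Fin n) (Fin N) ℝ) (k : ℝ) (hk : 0 < k)
    (Q : Fin m → Matrix (Fin n) (Fin n) ℝ) (b : Fin m → ℝ)
    (Y : Matrix (Fin N) (Fin N) ℝ) (hY0 : Y ≠ 0) (hYsym : Yᵀ = Y)
    (hrows : ∀ i, (fun j => Y i j) ∈ C) (hcols : ∀ j, (fun i => Y i j) ∈ C)
    (hhw : (hwM Y : ℝ) < α * (dmin C : ℝ) ^ 2)
    (hQ : ∀ ℓ, Qapp (Q ℓ) (T * Y * Tᵀ) = ((∑ i, Y i i) / k) * b ℓ) :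
    ∃ w : Fin n → ℝ, ∀ ℓ, Qapp (Q ℓ) (vecMulVec w w) = b ℓ := by
  obtain ⟨c, u, hc, hu, rfl⟩ := exists_eq_smul_vecMulVec_self hY0 hYsym
    (hno.not_linearIndependent_rows hrows hcols hhw)
  have hnorm : 0 < u ⬝ᵥ u :=
    lt_of_le_of_ne (Finset.sum_nonneg fun i _ => mul_self_nonneg (u i))
      (Ne.symm (mt dotProduct_self_eq_zero.mp hu))
  have htrace : ∑ i, (c • vecMulVec u u) i i = c * (u ⬝ᵥ u) := by
    simp [vecMulVec_apply, dotProduct, Finset.mul_sum]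
  have hconj : T * (c • vecMulVec u u) * Tᵀ = c • vecMulVec (T *ᵥ u) (T *ᵥ u) := by
    rw [Matrix.mul_smul, Matrix.smul_mul, mul_vecMulVec, vecMulVec_mul, vecMul_transpose]
  refine ⟨√(k / (u ⬝ᵥ u)) • (T *ᵥ u), fun ℓ => ?_⟩
  have h := hQ ℓ
  rw [htrace, hconj, Qapp_smul] at h
  rw [smul_vecMulVec, vecMulVec_smul, smul_smul, Real.mul_self_sqrt (by positivity), Qapp_smul]
  have h' : Qapp (Q ℓ) (vecMulVec (T *ᵥ u) (T *ᵥ u)) = (u ⬝ᵥ u) / k * b ℓ :=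
    mul_left_cancel₀ hc (by rw [h]; ring)
  rw [h']
  field_simp
end
end
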